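/- arXiv:2003.10030 — 6 statements merged into one kernel-verified Lean document; each statement's English description precedes it below -/
import Mathlib

section
/- Let κ be a regular cardinal and let c be a coloring of ^{κ>}2 using fewer than κ colors (i.e., c : ^{κ>}2 → Θ where Θ is a set of cardinality θ < κ). Then there is a map h : ^{ω>}2 → ^{κ>}2 such that h(η)⌢⟨0⟩ ⊴ h(η⌢⟨0⟩) and h(η)⌢⟨1⟩ ⊴ h(η⌢⟨1⟩) for every η ∈ ^{ω>}2, and the range of h is monochromatic, i.e., c(h(η)) = c(h(ν)) for all η, ν ∈ ^{ω>}2. (Lemma 2.10(2).) -/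
universe u

/-- Binary sequences of ordinal length `< κ`: an element of `^{κ>}2`.
Values beyond the length are normalized to `false`. -/
structure BinSeq (κ : Cardinal.{u}) where
  len : Ordinal.{u}
  len_lt : len < κ.ord
  val : Ordinal.{u} → Bool
  val_default : ∀ γ, len ≤ γ → val γ = false

/-- `η.Ext ν` means `η ⊴ ν`, i.e. `η` is an initial segment of `ν`. -/
def BinSeq.Ext {κ : Cardinal.{u}} (η ν : BinSeq κ) : Prop :=
  η.len ≤ ν.len ∧ ∀ γ < η.len, η.val γ = ν.val γ

theorem BinSeq.Ext.refl {κ : Cardinal.{u}} (η : BinSeq κ) : η.Ext η :=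
  ⟨le_rfl, fun _ _ => rfl⟩

theorem BinSeq.Ext.trans {κ : Cardinal.{u}} {η ν ρ : BinSeq κ} (h₁ : η.Ext ν) (h₂ : ν.Ext ρ) :
    η.Ext ρ :=
  ⟨h₁.1.trans h₂.1, fun γ hγ => (h₁.2 γ hγ).trans (h₂.2 γ (hγ.trans_le h₁.1))⟩

/-- A chain of fewer than `κ` sequences has an upper bound when `κ` is regular. -/
theorem BinSeq.exists_upper_bound {κ : Cardinal.{u}} (hκ : κ.IsRegular) {ι : Type u}
    (hι : Cardinal.mk ι < κ) (g : ι → BinSeq κ)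
    (hg : ∀ i j, (g i).Ext (g j) ∨ (g j).Ext (g i)) : ∃ u, ∀ i, (g i).Ext u := by
  classical
  have hle : ∀ i, (g i).len ≤ ⨆ j, (g j).len := Ordinal.le_iSup fun j => (g j).len
  refine ⟨⟨⨆ j, (g j).len, ?_, fun γ => decide (∃ j, γ < (g j).len ∧ (g j).val γ = true), ?_⟩, ?_⟩
  · exact Ordinal.iSup_lt_of_lt_cof (by rwa [hκ.cof_ord]) fun j => (g j).len_lt
  · intro γ hγ
    simp only [decide_eq_false_iff_not, not_exists, not_and]
    exact fun j hj => absurd (hj.trans_le (hle j)) hγ.not_gt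
  · refine fun i => ⟨hle i, fun γ hγ => ?_⟩
    rw [Bool.eq_iff_iff, decide_eq_true_iff]
    refine ⟨fun h => ⟨i, hγ, h⟩, ?_⟩
    rintro ⟨j, hj, h⟩
    rcases hg i j with hij | hji
    · exact (hij.2 γ hγ).trans h
    · exact (hji.2 γ hj).symm.trans h

/-- Above some sequence, one of the colors is dense. -/
theorem BinSeq.exists_dense_color {κ : Cardinal.{u}} (hκ : κ.IsRegular) {Θ : Type u}
    (hΘ : Cardinal.mk Θ < κ) (c : BinSeq κ → Θ) :
    ∃ (s : BinSeq κ) (a : Θ), ∀ t, s.Ext t → ∃ u, t.Ext u ∧ c u = a := by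
  classical
  by_contra! H
  choose f hf hfc using H
  have bound := fun (S : Set Θ) (g : S → BinSeq κ) =>
    BinSeq.exists_upper_bound hκ ((Cardinal.mk_set_le S).trans_lt hΘ) g
  obtain ⟨z, -⟩ := bound ∅ (fun x => x.2.elim) (fun x => x.2.elim)
  let r : Θ → Θ → Prop := WellOrderingRel
  let F : ∀ a, (∀ b, r b a → BinSeq κ) → BinSeq κ := fun a g =>
    f (if h : ∃ u, ∀ b hb, (g b hb).Ext u then h.choose else z) a
  have wf : WellFounded r := IsWellFounded.wf
  let p : Θ → BinSeq κ := wf.fix F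
  have chain_of : ∀ S : Set Θ, (∀ b ∈ S, ∀ b', r b' b → (p b').Ext (p b)) →
      ∃ u, ∀ b ∈ S, (p b).Ext u := by
    intro S hS
    obtain ⟨u, hu⟩ := bound S (fun b => p b) fun b b' => by
      rcases trichotomous_of r b.1 b'.1 with h | h | h
      · exact .inl (hS _ b'.2 _ h)
      · exact .inl (h ▸ BinSeq.Ext.refl _)
      · exact .inr (hS _ b.2 _ h)
    exact ⟨u, fun b hb => hu ⟨b, hb⟩⟩
  have mono : ∀ a, ∀ b, r b a → (p b).Ext (p a) := by
    intro a
    induction a using wf.induction with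
    | _ a ih =>
      have h : ∃ u, ∀ b, r b a → (p b).Ext u := chain_of {b | r b a} ih
      have hp : p a = f h.choose a := by
        change wf.fix F a = _
        rw [wf.fix_eq]
        exact congrArg (f · a) (dif_pos h)
      intro b hb
      rw [hp]
      exact (h.choose_spec b hb).trans (hf _ _)
  obtain ⟨u, hu⟩ := chain_of Set.univ fun b _ => mono b
  have hp : ∃ v, p (c u) = f v (c u) := ⟨_, wf.fix_eq F (c u)⟩
  obtain ⟨v, hv⟩ := hp
  exact hfc v (c u) u (hv ▸ hu (c u) trivial) rfl

/-- Every sequence `η` has a one-entry extension `η⌢⟨d⟩` when `κ` is infinite. -/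
theorem BinSeq.exists_snoc {κ : Cardinal.{u}} (hκ : Cardinal.aleph0 ≤ κ) (η : BinSeq κ)
    (d : Bool) : ∃ ν : BinSeq κ, η.Ext ν ∧ η.len < ν.len ∧ ν.val η.len = d := by
  classical
  refine ⟨⟨Order.succ η.len, (Cardinal.isSuccLimit_ord hκ).succ_lt η.len_lt,
    Function.update η.val η.len d, fun γ hγ => ?_⟩, ⟨Order.le_succ _, fun γ hγ => ?_⟩,
    Order.lt_succ _, by simp⟩
  · have h := Order.succ_le_iff.1 hγ
    rw [Function.update_of_ne h.ne', η.val_default γ h.le]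
  · exact (Function.update_of_ne hγ.ne _ _).symm

/-- Lemma 2.10(2): if `κ` is regular and `c` colors `^{κ>}2` with fewer than `κ`
colors, then there is an embedding `h : ^{ω>}2 → ^{κ>}2` (finite binary strings
are represented by `List Bool`) such that `h(η)⌢⟨d⟩ ⊴ h(η⌢⟨d⟩)` for each
`d ∈ {0,1}`, and the range of `h` is monochromatic. -/
theorem stmt1 {κ : Cardinal.{u}} (hκ : κ.IsRegular) {Θ : Type u}
    (hΘ : Cardinal.mk Θ < κ) (c : BinSeq κ → Θ) :
    ∃ h : List Bool → BinSeq κ,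
      (∀ (η : List Bool) (d : Bool),
        (h η).Ext (h (η ++ [d])) ∧
        (h η).len < (h (η ++ [d])).len ∧
        (h (η ++ [d])).val (h η).len = d) ∧
      (∀ η ν : List Bool, c (h η) = c (h ν)) := by
  obtain ⟨s, a, hs⟩ := BinSeq.exists_dense_color hκ hΘ c
  have step : ∀ (t : {t : BinSeq κ // s.Ext t ∧ c t = a}) (d : Bool),
      ∃ u : {t : BinSeq κ // s.Ext t ∧ c t = a},
        t.1.Ext u.1 ∧ t.1.len < u.1.len ∧ u.1.val t.1.len = d := by
    intro t d
    obtain ⟨v, hv, hlt, hd⟩ := BinSeq.exists_snoc hκ.aleph0_le t.1 d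
    obtain ⟨u, hu, hc⟩ := hs v (t.2.1.trans hv)
    exact ⟨⟨u, (t.2.1.trans hv).trans hu, hc⟩, hv.trans hu, hlt.trans_le hu.1,
      (hu.2 _ hlt).symm.trans hd⟩
  choose e he using step
  obtain ⟨u, hu, hc⟩ := hs s (BinSeq.Ext.refl s)
  refine ⟨fun η => (η.foldl e ⟨u, hu, hc⟩).1, fun η d => ?_, fun η ν => ?_⟩
  · simpa only [List.foldl_append, List.foldl_cons, List.foldl_nil] using he _ d
  · exact (List.foldl e _ η).2.2.trans (List.foldl e _ ν).2.2.symm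
end

section
/- Suppose ⟨σ₀,…,σₙ⟩ ≈_γ ⟨τ₀,…,τₙ⟩ are tuples of nonempty finite binary strings. Then cl(⟨σ₀⁻,…,σₙ⁻⟩) ≈_α cl(⟨τ₀⁻,…,τₙ⁻⟩). (Claim 3 in the proof of Lemma 3.6.) -/
/-- The meet `η ∧ ν` of two finite binary strings: their longest common prefix. -/
def lcp : List Bool → List Bool → List Bool
  | a :: as, b :: bs => if a = b then a :: lcp as bs else []
  | _, _ => []

/-- `η ⊥ ν`: the strings are incomparable (neither is a prefix of the other). -/
def Incomp (a b : List Bool) : Prop := ¬ a <+: b ∧ ¬ b <+: a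

/-- A tuple of strings is ∧-closed if the meet of any two entries is again an entry. -/
def MeetClosed {ι : Type*} (t : ι → List Bool) : Prop :=
  ∀ i j : ι, ∃ k : ι, lcp (t i) (t j) = t k

/-- `s ≈_α t`: both tuples are ∧-closed, and they satisfy the same
`⊴`-relations and the same `⌢⟨d⟩⊴`-relations between entries. -/
def EqvA {ι : Type*} (s t : ι → List Bool) : Prop :=
  MeetClosed s ∧ MeetClosed t ∧
  (∀ i j : ι, s i <+: s j ↔ t i <+: t j) ∧
  (∀ (i j : ι) (d : Bool), s i ++ [d] <+: s j ↔ t i ++ [d] <+: t j)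

/-- `s ≈_β t`: `≈_α` together with preservation of the relation `ηᵢ⌢⟨1⟩ = ηⱼ`. -/
def EqvB {ι : Type*} (s t : ι → List Bool) : Prop :=
  EqvA s t ∧ ∀ i j : ι, s i ++ [true] = s j ↔ t i ++ [true] = t j

/-- `s ≈_γ t`: `≈_β` together with preservation of `ηᵢ⌢⟨0⟩ = ηⱼ` and of
ending with `0` resp. with `1`. -/
def EqvG {ι : Type*} (s t : ι → List Bool) : Prop :=
  EqvB s t ∧
  (∀ i j : ι, s i ++ [false] = s j ↔ t i ++ [false] = t j) ∧
  (∀ i : ι, (s i).getLast? = some false ↔ (t i).getLast? = some false) ∧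
  (∀ i : ι, (s i).getLast? = some true ↔ (t i).getLast? = some true)

/-- The meet-closure tuple of a tuple of strings: all pairwise meets. -/
def cl {ι : Type*} (t : ι → List Bool) : ι × ι → List Bool :=
  fun p => lcp (t p.1) (t p.2)

theorem prefix_lcp_iff (c a b : List Bool) : c <+: lcp a b ↔ c <+: a ∧ c <+: b := by
  induction c generalizing a b with
  | nil => simp
  | cons x c ih =>
    cases a with
    | nil => simp [lcp]
    | cons y a =>
      cases b with
      | nil => simp [lcp]
      | cons z b =>
        by_cases hyz : y = z
        · subst hyz
          simp only [lcp, if_true, List.cons_prefix_cons, ih]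
          tauto
        · simp only [lcp, hyz, if_false, List.cons_prefix_cons]
          constructor
          · intro h
            simp at h
          · rintro ⟨⟨rfl, -⟩, ⟨rfl, -⟩⟩
            exact absurd rfl hyz

theorem prefix_antisymm {a b : List Bool} (h₁ : a <+: b) (h₂ : b <+: a) : a = b :=
  h₁.eq_of_length (le_antisymm h₁.length_le h₂.length_le)

theorem lcp_prefix_left (a b : List Bool) : lcp a b <+: a :=
  ((prefix_lcp_iff _ a b).1 List.prefix_rfl).1

theorem lcp_prefix_right (a b : List Bool) : lcp a b <+: b :=
  ((prefix_lcp_iff _ a b).1 List.prefix_rfl).2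

theorem lcp_comm (a b : List Bool) : lcp a b = lcp b a := by
  apply prefix_antisymm <;> rw [prefix_lcp_iff] <;>
    exact ⟨lcp_prefix_right _ _, lcp_prefix_left _ _⟩

theorem lcp_eq_left {a b : List Bool} (h : a <+: b) : lcp a b = a :=
  prefix_antisymm (lcp_prefix_left _ _) ((prefix_lcp_iff _ _ _).2 ⟨List.prefix_rfl, h⟩)

/-- Among three strings, the common meet is already one of two given pairwise meets. -/
theorem lcp_lcp_eq_or (x y z : List Bool) :
    lcp x (lcp y z) = lcp x y ∨ lcp x (lcp y z) = lcp x z := by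
  have key : ∀ y z, lcp x y <+: lcp x z → lcp x (lcp y z) = lcp x y := by
    intro y z h
    apply prefix_antisymm <;> simp only [prefix_lcp_iff]
    · exact ⟨lcp_prefix_left _ _, (lcp_prefix_right _ _).trans (lcp_prefix_left _ _)⟩
    · exact ⟨lcp_prefix_left _ _, lcp_prefix_right _ _, h.trans (lcp_prefix_right _ _)⟩
  rcases List.prefix_or_prefix_of_prefix (lcp_prefix_left x y) (lcp_prefix_left x z) with h | h
  · exact Or.inl (key y z h)
  · rw [lcp_comm y z]
    exact Or.inr (key z y h)

theorem meetClosed_cl {ι : Type*} (t : ι → List Bool) : MeetClosed (cl t) := by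
  have triple : ∀ i j k, ∃ p, lcp (t k) (lcp (t i) (t j)) = cl t p := by
    intro i j k
    rcases lcp_lcp_eq_or (t k) (t i) (t j) with h | h
    · exact ⟨(k, i), h⟩
    · exact ⟨(k, j), h⟩
  rintro ⟨i, j⟩ ⟨k, l⟩
  simp only [cl] at triple ⊢
  rcases lcp_lcp_eq_or (lcp (t i) (t j)) (t k) (t l) with h | h <;> rw [h, lcp_comm]
  · exact triple i j k
  · exact triple i j l

theorem prefix_iff_eq_or_append {a b : List Bool} :
    a <+: b ↔ a = b ∨ ∃ d, a ++ [d] <+: b := by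
  constructor
  · rintro ⟨c, rfl⟩
    cases c with
    | nil => simp
    | cons d c => exact Or.inr ⟨d, c, by simp⟩
  · rintro (rfl | ⟨d, h⟩)
    · exact List.prefix_rfl
    · exact (List.prefix_append _ _).trans h

theorem dropLast_eq_iff {a b : List Bool} (ha : a ≠ []) :
    a.dropLast = b ↔ ∃ e, b ++ [e] = a := by
  constructor
  · rintro rfl
    exact ⟨_, List.dropLast_append_getLast ha⟩
  · rintro ⟨e, rfl⟩
    simp

theorem prefix_dropLast_iff {a b : List Bool} (hb : b ≠ []) :
    a <+: b.dropLast ↔ a <+: b ∧ a ≠ b := by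
  obtain ⟨c, e, rfl⟩ : ∃ c e, b = c ++ [e] := ⟨_, _, (List.dropLast_append_getLast hb).symm⟩
  rw [List.dropLast_concat, List.prefix_concat_iff]
  constructor
  · intro h
    refine ⟨Or.inr h, ?_⟩
    rintro rfl
    have := h.length_le
    simp at this
  · rintro ⟨h | h, h'⟩
    · exact absurd h h'
    · exact h

theorem append_prefix_append_iff {a : List Bool} {d e : Bool} :
    a ++ [d] <+: a ++ [e] ↔ d = e := by
  simp

/-- Strings branching off in different directions from `c` have meet `c`. -/
theorem lcp_eq_of_branch {a b c : List Bool} {d e : Bool} (hde : d ≠ e)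
    (ha : c ++ [d] <+: a) (hb : c ++ [e] <+: b) : lcp a b = c := by
  have hc : c <+: lcp a b := (prefix_lcp_iff _ _ _).2
    ⟨(List.prefix_append _ _).trans ha, (List.prefix_append _ _).trans hb⟩
  rcases prefix_iff_eq_or_append.1 hc with h | ⟨f, h⟩
  · exact h.symm
  · rw [prefix_lcp_iff] at h
    have key : ∀ {g : Bool} {x : List Bool}, c ++ [f] <+: x → c ++ [g] <+: x → f = g :=
      fun h₁ h₂ => (append_prefix_append_iff (a := c)).1 (List.prefix_of_prefix_length_le h₁ h₂ (by simp))
    exact absurd ((key h.1 ha).symm.trans (key h.2 hb)) hde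

/-- Incomparable strings branch off in different directions from their meet. -/
theorem exists_branch_of_incomp {a b : List Bool} (h : Incomp a b) :
    ∃ d e, d ≠ e ∧ lcp a b ++ [d] <+: a ∧ lcp a b ++ [e] <+: b := by
  have left := prefix_iff_eq_or_append.1 (lcp_prefix_left a b)
  have right := prefix_iff_eq_or_append.1 (lcp_prefix_right a b)
  rcases left with hl | ⟨d, hd⟩
  · exact absurd (hl ▸ lcp_prefix_right a b) h.1
  rcases right with hr | ⟨e, he⟩
  · exact absurd (hr ▸ lcp_prefix_left a b) h.2
  refine ⟨d, e, ?_, hd, he⟩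
  rintro rfl
  have := ((prefix_lcp_iff _ a b).2 ⟨hd, he⟩).length_le
  simp at this

theorem lcp_dropLast_of_incomp {a b : List Bool} (h : Incomp a b) :
    lcp a.dropLast b.dropLast = lcp a b := by
  have ha : a ≠ [] := fun h' => h.1 (h' ▸ List.nil_prefix)
  have hb : b ≠ [] := fun h' => h.2 (h' ▸ List.nil_prefix)
  apply prefix_antisymm <;> rw [prefix_lcp_iff]
  · exact ⟨(lcp_prefix_left _ _).trans (List.dropLast_prefix _),
      (lcp_prefix_right _ _).trans (List.dropLast_prefix _)⟩
  · rw [prefix_dropLast_iff ha, prefix_dropLast_iff hb]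
    exact ⟨⟨lcp_prefix_left _ _, fun h' => h.1 (h' ▸ lcp_prefix_right a b)⟩,
      ⟨lcp_prefix_right _ _, fun h' => h.2 (h' ▸ lcp_prefix_left a b)⟩⟩

theorem lcp_dropLast_of_prefix {a b : List Bool} (ha : a ≠ []) (h : a <+: b) :
    lcp a.dropLast b.dropLast = a.dropLast := by
  have hb : b ≠ [] := by
    rintro rfl
    exact ha (List.prefix_nil.1 h)
  apply lcp_eq_left
  rw [prefix_dropLast_iff hb]
  refine ⟨(List.dropLast_prefix _).trans h, ?_⟩
  rintro rfl
  obtain ⟨e, he⟩ := (dropLast_eq_iff ha).1 rfl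
  have h₁ := h.length_le
  have h₂ := congrArg List.length he
  simp only [List.length_append, List.length_singleton] at h₂
  omega

section Characterizations

variable {ι : Type*} {s : ι → List Bool}

theorem dropLast_append_prefix_iff (hs : MeetClosed s) {i : ι} (hi : s i ≠ []) (j : ι)
    (d : Bool) :
    (s i).dropLast ++ [d] <+: s j ↔
      ((s i).getLast? = some d ∧ s i <+: s j) ∨
        ∃ k e, s k ++ [e] = s i ∧ s k ++ [d] <+: s j := by
  obtain ⟨c, e, hc⟩ : ∃ c e, c ++ [e] = s i := ⟨_, _, List.dropLast_append_getLast hi⟩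
  rw [← hc, List.dropLast_concat, List.getLast?_concat]
  constructor
  · intro h
    by_cases hde : e = d
    · subst hde
      exact Or.inl ⟨rfl, h⟩
    · obtain ⟨k, hk⟩ := hs i j
      rw [lcp_eq_of_branch hde (hc ▸ List.prefix_rfl) h] at hk
      subst hk
      exact Or.inr ⟨k, e, rfl, h⟩
  · rintro (⟨hd, h⟩ | ⟨k, f, hk, h⟩)
    · rwa [← Option.some.inj hd]
    · rwa [← (List.append_inj' hk rfl).1]

theorem dropLast_append_eq_iff (hs : MeetClosed s) {i : ι} (hi : s i ≠ []) (j : ι)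
    (d : Bool) :
    (s i).dropLast ++ [d] = s j ↔
      ((s i).getLast? = some d ∧ s i = s j) ∨
        ∃ k e, s k ++ [e] = s i ∧ s k ++ [d] = s j := by
  constructor
  · intro h
    rcases (dropLast_append_prefix_iff hs hi j d).1 (h ▸ List.prefix_rfl) with
      ⟨hd, -⟩ | ⟨k, e, hk, -⟩
    · exact Or.inl ⟨hd, by rw [← h, List.dropLast_append_getLast? d hd]⟩
    · refine Or.inr ⟨k, e, hk, ?_⟩
      rwa [← hk, List.dropLast_concat] at h
  · rintro (⟨hd, h⟩ | ⟨k, e, hk, h⟩)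
    · rw [← h, List.dropLast_append_getLast? d hd]
    · rwa [← hk, List.dropLast_concat]

end Characterizations

section Equivalence

variable {ι : Type*} {s t : ι → List Bool}

theorem EqvG.prefix_iff (h : EqvG s t) (i j : ι) : s i <+: s j ↔ t i <+: t j :=
  h.1.1.2.2.1 i j

theorem EqvG.append_prefix_iff (h : EqvG s t) (i j : ι) (d : Bool) :
    s i ++ [d] <+: s j ↔ t i ++ [d] <+: t j :=
  h.1.1.2.2.2 i j d

theorem EqvG.append_eq_iff (h : EqvG s t) (i j : ι) (d : Bool) :
    s i ++ [d] = s j ↔ t i ++ [d] = t j := by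
  cases d
  · exact h.2.1 i j
  · exact h.1.2 i j

theorem EqvG.getLast_iff (h : EqvG s t) (i : ι) (d : Bool) :
    (s i).getLast? = some d ↔ (t i).getLast? = some d := by
  cases d
  · exact h.2.2.1 i
  · exact h.2.2.2 i

theorem EqvG.eq_iff (h : EqvG s t) (i j : ι) : s i = s j ↔ t i = t j := by
  constructor <;> intro e
  · exact prefix_antisymm ((h.prefix_iff i j).1 (e ▸ List.prefix_rfl))
      ((h.prefix_iff j i).1 (e ▸ List.prefix_rfl))
  · exact prefix_antisymm ((h.prefix_iff i j).2 (e ▸ List.prefix_rfl))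
      ((h.prefix_iff j i).2 (e ▸ List.prefix_rfl))

/-- The tuple of all entries of `s` together with all their predecessors. -/
def withPred (s : ι → List Bool) (p : ι × Bool) : List Bool :=
  if p.2 then (s p.1).dropLast else s p.1

theorem EqvG.withPred_append_prefix_entry (h : EqvG s t) (hs : ∀ i, s i ≠ [])
    (ht : ∀ i, t i ≠ []) (p : ι × Bool) (j : ι) (d : Bool) :
    withPred s p ++ [d] <+: s j ↔ withPred t p ++ [d] <+: t j := by
  obtain ⟨i, _ | _⟩ := p
  · exact h.append_prefix_iff i j d
  · simp only [withPred, if_true, dropLast_append_prefix_iff h.1.1.1 (hs i),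
      dropLast_append_prefix_iff h.1.1.2.1 (ht i), h.getLast_iff, h.prefix_iff,
      h.append_eq_iff, h.append_prefix_iff]

theorem EqvG.withPred_append_eq_entry (h : EqvG s t) (hs : ∀ i, s i ≠ [])
    (ht : ∀ i, t i ≠ []) (p : ι × Bool) (j : ι) (d : Bool) :
    withPred s p ++ [d] = s j ↔ withPred t p ++ [d] = t j := by
  obtain ⟨i, _ | _⟩ := p
  · exact h.append_eq_iff i j d
  · simp only [withPred, if_true, dropLast_append_eq_iff h.1.1.1 (hs i),
      dropLast_append_eq_iff h.1.1.2.1 (ht i), h.getLast_iff, h.eq_iff, h.append_eq_iff]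

theorem EqvG.withPred_append_prefix (h : EqvG s t) (hs : ∀ i, s i ≠ [])
    (ht : ∀ i, t i ≠ []) (p q : ι × Bool) (d : Bool) :
    withPred s p ++ [d] <+: withPred s q ↔ withPred t p ++ [d] <+: withPred t q := by
  have h₁ := h.withPred_append_prefix_entry hs ht p q.1 d
  have h₂ := h.withPred_append_eq_entry hs ht p q.1 d
  obtain ⟨j, _ | _⟩ := q
  · exact h₁
  · change _ <+: (s j).dropLast ↔ _ <+: (t j).dropLast
    rw [prefix_dropLast_iff (hs j), prefix_dropLast_iff (ht j), h₁, Ne, h₂]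

theorem EqvG.withPred_eq (h : EqvG s t) (hs : ∀ i, s i ≠ [])
    (ht : ∀ i, t i ≠ []) (p q : ι × Bool) :
    withPred s p = withPred s q ↔ withPred t p = withPred t q := by
  have toPred : ∀ (p : ι × Bool) (j : ι),
      withPred s p = (s j).dropLast ↔ withPred t p = (t j).dropLast := by
    intro p j
    simp only [eq_comm (b := (s j).dropLast), eq_comm (b := (t j).dropLast),
      dropLast_eq_iff (hs j), dropLast_eq_iff (ht j), h.withPred_append_eq_entry hs ht]
  obtain ⟨j, _ | _⟩ := q
  · obtain ⟨i, _ | _⟩ := p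
    · exact h.eq_iff i j
    · rw [eq_comm, eq_comm (a := withPred t _)]
      exact toPred (j, false) i
  · exact toPred p j

theorem EqvG.withPred_prefix (h : EqvG s t) (hs : ∀ i, s i ≠ [])
    (ht : ∀ i, t i ≠ []) (p q : ι × Bool) :
    withPred s p <+: withPred s q ↔ withPred t p <+: withPred t q := by
  rw [prefix_iff_eq_or_append, prefix_iff_eq_or_append (a := withPred t p)]
  simp only [h.withPred_eq hs ht, h.withPred_append_prefix hs ht]

/-- Each meet of two predecessors is an entry or the predecessor of an entry,
at the same position in both tuples. -/
theorem EqvG.exists_cl_dropLast_eq (h : EqvG s t) (hs : ∀ i, s i ≠ [])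
    (ht : ∀ i, t i ≠ []) (p : ι × ι) :
    ∃ q, cl (fun i => (s i).dropLast) p = withPred s q ∧
      cl (fun i => (t i).dropLast) p = withPred t q := by
  obtain ⟨i, j⟩ := p
  simp only [cl]
  by_cases hij : s i <+: s j
  · exact ⟨(i, true), lcp_dropLast_of_prefix (hs i) hij,
      lcp_dropLast_of_prefix (ht i) ((h.prefix_iff i j).1 hij)⟩
  by_cases hji : s j <+: s i
  · rw [lcp_comm, lcp_comm (t i).dropLast]
    exact ⟨(j, true), lcp_dropLast_of_prefix (hs j) hji,
      lcp_dropLast_of_prefix (ht j) ((h.prefix_iff j i).1 hji)⟩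
  obtain ⟨k, hk⟩ := h.1.1.1 i j
  obtain ⟨d, e, hde, hd, he⟩ := exists_branch_of_incomp ⟨hij, hji⟩
  rw [hk, h.append_prefix_iff] at hd he
  refine ⟨(k, false), (lcp_dropLast_of_incomp ⟨hij, hji⟩).trans hk, ?_⟩
  rw [h.prefix_iff] at hij hji
  exact (lcp_dropLast_of_incomp ⟨hij, hji⟩).trans (lcp_eq_of_branch hde hd he)

end Equivalence

/-- Claim 3 in the proof of Lemma 3.6: if `⟨σ₀,…,σₙ⟩ ≈_γ ⟨τ₀,…,τₙ⟩` are tuples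
of nonempty strings, then the meet-closures of the tuples of predecessors are
`≈_α`-equivalent. -/
theorem stmt6 {n : ℕ} (σ τ : Fin (n + 1) → List Bool)
    (hσne : ∀ i, σ i ≠ []) (hτne : ∀ i, τ i ≠ [])
    (h : EqvG σ τ) :
    EqvA (cl (fun i => (σ i).dropLast)) (cl (fun i => (τ i).dropLast)) := by
  refine ⟨meetClosed_cl _, meetClosed_cl _, ?_, ?_⟩
  · intro p q
    obtain ⟨p', hp, hp'⟩ := h.exists_cl_dropLast_eq hσne hτne p
    obtain ⟨q', hq, hq'⟩ := h.exists_cl_dropLast_eq hσne hτne q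
    rw [hp, hp', hq, hq']
    exact h.withPred_prefix hσne hτne p' q'
  · intro p q d
    obtain ⟨p', hp, hp'⟩ := h.exists_cl_dropLast_eq hσne hτne p
    obtain ⟨q', hq, hq'⟩ := h.exists_cl_dropLast_eq hσne hτne q
    rw [hp, hp', hq, hq']
    exact h.withPred_append_prefix hσne hτne p' q' d
end

section
/- Define h : ^{<ω}2 → ^{<ω}2 recursively by h(⟨⟩) = ⟨⟩, h(η⌢⟨0⟩) = h(η)⌢⟨0,1⟩, and h(η⌢⟨1⟩) = h(η)⌢⟨1⟩. If ⟨η₀,…,ηₙ⟩ ≈_β ⟨ν₀,…,νₙ⟩ and moreover ηᵢ is the empty string if and only if νᵢ is the empty string (for each i ≤ n), then ⟨h(η₀),…,h(ηₙ)⟩ ≈_γ ⟨h(ν₀),…,h(νₙ)⟩. (Claim 1 in the proof of Theorem 3.8.) -/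
/-- The homomorphism of strings sending `0` to `01` and `1` to `1`. -/
def insertOnes : List Bool → List Bool
  | [] => []
  | false :: l => false :: true :: insertOnes l
  | true :: l => true :: insertOnes l

theorem insertOnes_append (a b : List Bool) :
    insertOnes (a ++ b) = insertOnes a ++ insertOnes b := by
  induction a with
  | nil => rfl
  | cons x a ih => cases x <;> simp [insertOnes, ih]

theorem lcp_insertOnes (a b : List Bool) :
    lcp (insertOnes a) (insertOnes b) = insertOnes (lcp a b) := by
  induction a generalizing b with
  | nil => simp [insertOnes, lcp]
  | cons x a ih =>
    cases b with
    | nil => cases x <;> simp [insertOnes, lcp]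
    | cons y b => cases x <;> cases y <;> simp [insertOnes, lcp, ih]

theorem insertOnes_prefix_iff (a b : List Bool) :
    insertOnes a <+: insertOnes b ↔ a <+: b := by
  induction a generalizing b with
  | nil => simp [insertOnes]
  | cons x a ih =>
    cases b with
    | nil => cases x <;> simp [insertOnes]
    | cons y b => cases x <;> cases y <;> simp [insertOnes, List.cons_prefix_cons, ih]

theorem insertOnes_append_singleton_prefix_iff (a b : List Bool) (d : Bool) :
    insertOnes a ++ [d] <+: insertOnes b ↔ a ++ [d] <+: b := by
  induction a generalizing b with
  | nil =>
    cases b with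
    | nil => simp [insertOnes]
    | cons y b => cases y <;> cases d <;> simp [insertOnes, List.cons_prefix_cons]
  | cons x a ih =>
    cases b with
    | nil => cases x <;> simp [insertOnes]
    | cons y b => cases x <;> cases y <;> simp [insertOnes, List.cons_prefix_cons, ih]

theorem insertOnes_injective : Function.Injective insertOnes := fun a b hab =>
  ((insertOnes_prefix_iff a b).1 (hab ▸ List.prefix_rfl)).eq_of_length_le
    ((insertOnes_prefix_iff b a).1 (hab ▸ List.prefix_rfl)).length_le

theorem getLast?_insertOnes (a : List Bool) :
    (insertOnes a).getLast? = if a = [] then none else some true := by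
  induction a using List.reverseRecOn with
  | nil => rfl
  | append_singleton a x _ => cases x <;> simp [insertOnes_append, insertOnes]

theorem MeetClosed.insertOnes {ι : Type*} {t : ι → List Bool} (ht : MeetClosed t) :
    MeetClosed fun i => insertOnes (t i) := fun i j =>
  (ht i j).imp fun k hk => by rw [lcp_insertOnes, hk]

theorem insertOnes_append_true_eq_iff (a b : List Bool) :
    insertOnes a ++ [true] = insertOnes b ↔ a ++ [true] = b := by
  rw [← insertOnes_injective.eq_iff (a := a ++ [true]), insertOnes_append]
  rfl

theorem insertOnes_append_false_ne (a b : List Bool) :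
    insertOnes a ++ [false] ≠ insertOnes b := fun hab => by
  have hlast := congrArg List.getLast? hab
  rw [getLast?_insertOnes] at hlast
  split at hlast <;> simp at hlast

theorem eq_insertOnes {h : List Bool → List Bool} (h0 : h [] = [])
    (hF : ∀ η : List Bool, h (η ++ [false]) = h η ++ [false, true])
    (hT : ∀ η : List Bool, h (η ++ [true]) = h η ++ [true]) :
    h = insertOnes := by
  funext a
  induction a using List.reverseRecOn with
  | nil => exact h0
  | append_singleton a x ih => cases x <;> simp [hF, hT, ih, insertOnes_append, insertOnes]

/-- Claim 1 in the proof of Theorem 3.8: for the map `h` determined by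
`h(⟨⟩) = ⟨⟩`, `h(η⌢⟨0⟩) = h(η)⌢⟨0,1⟩`, `h(η⌢⟨1⟩) = h(η)⌢⟨1⟩`, if
`⟨η₀,…,ηₙ⟩ ≈_β ⟨ν₀,…,νₙ⟩` and `ηᵢ = ⟨⟩ ↔ νᵢ = ⟨⟩` for each `i`, then
`⟨h(η₀),…,h(ηₙ)⟩ ≈_γ ⟨h(ν₀),…,h(νₙ)⟩`. -/
theorem stmt9 (h : List Bool → List Bool)
    (h0 : h [] = [])
    (hF : ∀ η : List Bool, h (η ++ [false]) = h η ++ [false, true])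
    (hT : ∀ η : List Bool, h (η ++ [true]) = h η ++ [true])
    {n : ℕ} (η ν : Fin (n + 1) → List Bool)
    (hβ : EqvB η ν)
    (hemp : ∀ i, η i = [] ↔ ν i = []) :
    EqvG (fun i => h (η i)) (fun i => h (ν i)) := by
  obtain rfl := eq_insertOnes h0 hF hT
  obtain ⟨⟨hη, hν, hpre, happ⟩, htrue⟩ := hβ
  refine ⟨⟨⟨hη.insertOnes, hν.insertOnes, fun i j => ?_, fun i j d => ?_⟩, fun i j => ?_⟩,
    fun i j => ?_, fun i => ?_, fun i => ?_⟩
  · simpa only [insertOnes_prefix_iff] using hpre i j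
  · simpa only [insertOnes_append_singleton_prefix_iff] using happ i j d
  · simpa only [insertOnes_append_true_eq_iff] using htrue i j
  · exact iff_of_false (insertOnes_append_false_ne _ _) (insertOnes_append_false_ne _ _)
  · simp only [getLast?_insertOnes, hemp i]
  · simp only [getLast?_insertOnes, hemp i]
end

section
/- There exists a map h : ^{<ω}2 → ^{<ω}2 such that: (i) for every finite binary string η and all i < j ≤ |η|, the strings h(η↾i) and h(η↾j) are incomparable (h maps every chain of initial segments to an antichain); and (ii) for all finite binary strings η and ν, h(η⌢⟨1⟩) ◁ h(η⌢⟨0⟩⌢ν). (Combinatorial core of Proposition 4.5: an antichain tree yields a witness of SOP₁; such an h is given recursively by h(⟨⟩) = ⟨1⟩, h(⟨0⟩⌢ν) = ⟨0,1,1⟩⌢h(ν), h(⟨1⟩⌢ν) = ⟨0⟩⌢h(ν).) -/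
/-- The map `h` with `h(⟨⟩) = ⟨1⟩`, `h(⟨0⟩⌢ν) = ⟨0,1,1⟩⌢h(ν)` and `h(⟨1⟩⌢ν) = ⟨0⟩⌢h(ν)`. -/
def antichainMap : List Bool → List Bool
  | [] => [true]
  | false :: ν => [false, true, true] ++ antichainMap ν
  | true :: ν => [false] ++ antichainMap ν

theorem incomp_antichainMap_append (η ν : List Bool) (hν : ν ≠ []) :
    Incomp (antichainMap η) (antichainMap (η ++ ν)) := by
  induction η with
  | nil =>
    obtain _ | ⟨_ | _, ν⟩ := ν
    · exact absurd rfl hν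
    all_goals simp [Incomp, antichainMap]
  | cons b η ih => cases b <;> simpa [Incomp, antichainMap] using ih

theorem antichainMap_append_true_prefix (η ν : List Bool) :
    antichainMap (η ++ [true]) <+: antichainMap (η ++ [false] ++ ν) ∧
      antichainMap (η ++ [true]) ≠ antichainMap (η ++ [false] ++ ν) := by
  induction η with
  | nil => simp [antichainMap]
  | cons b η ih => cases b <;> simpa [antichainMap] using ih

/-- Combinatorial core of Proposition 4.5: there is a map `h : ^{<ω}2 → ^{<ω}2`
mapping every chain of initial segments to an antichain, and such that
`h(η⌢⟨1⟩) ◁ h(η⌢⟨0⟩⌢ν)` for all `η, ν`. -/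
theorem stmt10 :
    ∃ h : List Bool → List Bool,
      (∀ (η : List Bool) (i j : ℕ), i < j → j ≤ η.length →
        Incomp (h (η.take i)) (h (η.take j))) ∧
      (∀ η ν : List Bool,
        h (η ++ [true]) <+: h (η ++ [false] ++ ν) ∧
        h (η ++ [true]) ≠ h (η ++ [false] ++ ν)) := by
  refine ⟨antichainMap, fun η i j hij hj => ?_, antichainMap_append_true_prefix⟩
  obtain ⟨ν, hν⟩ := List.take_prefix_take_left (l := η) hij.le
  rw [← hν]
  refine incomp_antichainMap_append _ _ ?_
  rintro rfl
  have := congrArg List.length hν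
  simp only [List.append_nil, List.length_take] at this
  omega
end

section
/- Define g : ^{<ω}2 → ^{<ω}2 recursively by g(⟨⟩) = ⟨0⟩, g(η⌢⟨0⟩) = g(η)⁻⌢⟨1,0,0,0⟩, and g(η⌢⟨1⟩) = g(η)⁻⌢⟨1,0⟩. Then g is injective, and for all distinct finite binary strings η, ν the following are equivalent: (a) g(η) and g(ν) are comparable (g(η) ⊴ g(ν) or g(ν) ⊴ g(η)); (b) there exist finite binary strings ξ, ρ such that {η, ν} = {ξ⌢⟨1⟩, ξ⌢⟨0⟩⌢ρ}. (Combinatorial core of Proposition 5.3: composing an antichain tree with g produces a witness of SSOP₁.) -/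
/-- The morphism of binary strings with `0 ↦ 100` and `1 ↦ 1`. -/
def blockCode : List Bool → List Bool
  | [] => []
  | false :: l => true :: false :: false :: blockCode l
  | true :: l => true :: blockCode l

theorem blockCode_append (l m : List Bool) :
    blockCode (l ++ m) = blockCode l ++ blockCode m := by
  induction l with
  | nil => rfl
  | cons a l ih => cases a <;> simp [blockCode, ih]

theorem blockCode_append_false_injective :
    Function.Injective fun l => blockCode l ++ [false] := by
  intro l m h
  induction l generalizing m with
  | nil => rcases m with _ | ⟨_ | _, m⟩ <;> simp_all [blockCode]
  | cons a l ih =>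
    rcases a with _ | _ <;> rcases m with _ | ⟨_ | _, m⟩ <;> simp [blockCode] at h
    · rw [ih (by simpa using h)]
    · rcases m with _ | ⟨_ | _, m⟩ <;> simp [blockCode] at h
    · rcases l with _ | ⟨_ | _, l⟩ <;> simp [blockCode] at h
    · rw [ih (by simpa using h)]

theorem exists_fork_cons_cons_iff (a : Bool) (l m : List Bool) :
    (∃ ξ ρ, a :: l = ξ ++ [true] ∧ a :: m = ξ ++ [false] ++ ρ) ↔
      ∃ ξ ρ, l = ξ ++ [true] ∧ m = ξ ++ [false] ++ ρ := by
  constructor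
  · rintro ⟨_ | ⟨b, ξ⟩, ρ, h, h'⟩
    · simp_all
    · exact ⟨ξ, ρ, by simp_all, by simp_all⟩
  · rintro ⟨ξ, ρ, rfl, rfl⟩
    exact ⟨a :: ξ, ρ, by simp, by simp⟩

theorem blockCode_append_false_prefix_iff (l m : List Bool) :
    blockCode l ++ [false] <+: blockCode m ++ [false] ↔
      l = m ∨ ∃ ξ ρ, l = ξ ++ [true] ∧ m = ξ ++ [false] ++ ρ := by
  induction l generalizing m with
  | nil => rcases m with _ | ⟨_ | _, m⟩ <;> simp [blockCode]
  | cons a l ih =>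
    rcases m with _ | ⟨b, m⟩
    · cases a <;> simp [blockCode]
    · by_cases hab : a = b
      · subst hab
        rw [exists_fork_cons_cons_iff, List.cons_inj_right, ← ih]
        cases a <;> simp [blockCode]
      · have hfork : (∃ ξ ρ, a :: l = ξ ++ [true] ∧ b :: m = ξ ++ [false] ++ ρ) ↔
            a = true ∧ l = [] := by
          constructor
          · rintro ⟨_ | ⟨c, ξ⟩, ρ, h, h'⟩ <;> simp_all
          · rintro ⟨rfl, rfl⟩
            exact ⟨[], m, by simp, by simpa using Ne.symm hab⟩
        rw [hfork]
        cases a <;> cases b <;> simp at hab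
        · rcases m with _ | ⟨_ | _, m⟩ <;> simp [blockCode]
        · rcases l with _ | ⟨_ | _, l⟩ <;> simp [blockCode]

/-- Combinatorial core of Proposition 5.3, for the map `g` determined by
`g(⟨⟩) = ⟨0⟩`, `g(η⌢⟨0⟩) = g(η)⁻⌢⟨1,0,0,0⟩`, `g(η⌢⟨1⟩) = g(η)⁻⌢⟨1,0⟩`:
`g` is injective, and for distinct `η, ν`, the images `g(η), g(ν)` are
comparable iff `{η, ν}` is of the form `{ξ⌢⟨1⟩, ξ⌢⟨0⟩⌢ρ}`. -/
theorem stmt17 (g : List Bool → List Bool)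
    (g0 : g [] = [false])
    (gF : ∀ η : List Bool, g (η ++ [false]) = (g η).dropLast ++ [true, false, false, false])
    (gT : ∀ η : List Bool, g (η ++ [true]) = (g η).dropLast ++ [true, false]) :
    Function.Injective g ∧
    ∀ η ν : List Bool, η ≠ ν →
      ((g η <+: g ν ∨ g ν <+: g η) ↔
        ∃ ξ ρ : List Bool,
          (η = ξ ++ [true] ∧ ν = ξ ++ [false] ++ ρ) ∨
          (ν = ξ ++ [true] ∧ η = ξ ++ [false] ++ ρ)) := by
  have hg : ∀ η, g η = blockCode η ++ [false] := by
    intro η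
    induction η using List.reverseRecOn with
    | nil => exact g0
    | append_singleton η a ih => cases a <;> simp [gF, gT, ih, blockCode_append, blockCode]
  refine ⟨(funext hg : g = _) ▸ blockCode_append_false_injective, fun η ν hne => ?_⟩
  simp only [hg, blockCode_append_false_prefix_iff, hne, hne.symm, false_or, exists_or]
end

section
/- Define h : ^{<ω}2 → ^{<ω}2 recursively by h(⟨⟩) = ⟨1⟩, h(η⌢⟨0⟩) = h(η)⁻⌢⟨0,0,1⟩, and h(η⌢⟨1⟩) = h(η)⁻⌢⟨0,1,1⟩. Then h is injective, and for all distinct finite binary strings η, ν the following are equivalent: (a) η and ν are comparable (η ⊴ ν or ν ⊴ η); (b) there exist finite binary strings ξ, ρ such that {h(η), h(ν)} = {ξ⌢⟨1⟩, ξ⌢⟨0⟩⌢ρ}. (Combinatorial core of Proposition 5.5: composing a witness of SSOP₁ with h produces an antichain tree.) -/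
/-- Precede every entry of `η` by `0`. -/
def padZero (η : List Bool) : List Bool := η.flatMap fun b => [false, b]

theorem padZero_cons (b : Bool) (η : List Bool) :
    padZero (b :: η) = false :: b :: padZero η := rfl

theorem padZero_append (η ν : List Bool) : padZero (η ++ ν) = padZero η ++ padZero ν :=
  List.flatMap_append

theorem padZero_injective : Function.Injective padZero := by
  intro η
  induction η with
  | nil => intro ν hν; cases ν <;> simp_all [padZero]
  | cons a η ih =>
    intro ν hν
    cases ν with
    | nil => simp [padZero] at hν
    | cons b ν =>
      simp only [padZero_cons, List.cons.injEq, true_and] at hν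
      rw [hν.1, ih hν.2]

theorem prefix_of_padZero_eq {η ν ρ : List Bool}
    (e : padZero ν ++ [true] = padZero η ++ [false] ++ ρ) : η <+: ν := by
  induction η generalizing ν with
  | nil => exact List.nil_prefix
  | cons a η ih =>
    cases ν with
    | nil => simp [padZero] at e
    | cons b ν =>
      simp only [padZero_cons, List.cons_append, List.cons.injEq, true_and] at e
      rw [e.1, List.cons_prefix_cons]
      exact ⟨rfl, ih e.2⟩

theorem exists_padZero_eq_of_prefix {η ν : List Bool} (hne : η ≠ ν) (hp : η <+: ν) :
    ∃ ρ, padZero ν ++ [true] = padZero η ++ [false] ++ ρ := by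
  obtain ⟨σ, rfl⟩ := hp
  cases σ with
  | nil => simp at hne
  | cons b σ => exact ⟨b :: padZero σ ++ [true], by simp [padZero_append, padZero_cons]⟩

/-- Combinatorial core of Proposition 5.5, for the map `h` determined by
`h(⟨⟩) = ⟨1⟩`, `h(η⌢⟨0⟩) = h(η)⁻⌢⟨0,0,1⟩`, `h(η⌢⟨1⟩) = h(η)⁻⌢⟨0,1,1⟩`:
`h` is injective, and for distinct `η, ν`, the strings `η, ν` are comparable
iff `{h(η), h(ν)}` is of the form `{ξ⌢⟨1⟩, ξ⌢⟨0⟩⌢ρ}`. -/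
theorem stmt18 (h : List Bool → List Bool)
    (h0 : h [] = [true])
    (hF : ∀ η : List Bool, h (η ++ [false]) = (h η).dropLast ++ [false, false, true])
    (hT : ∀ η : List Bool, h (η ++ [true]) = (h η).dropLast ++ [false, true, true]) :
    Function.Injective h ∧
    ∀ η ν : List Bool, η ≠ ν →
      ((η <+: ν ∨ ν <+: η) ↔
        ∃ ξ ρ : List Bool,
          (h η = ξ ++ [true] ∧ h ν = ξ ++ [false] ++ ρ) ∨
          (h ν = ξ ++ [true] ∧ h η = ξ ++ [false] ++ ρ)) := by
  have hh : ∀ η, h η = padZero η ++ [true] := by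
    intro η
    induction η using List.reverseRecOn with
    | nil => simpa [padZero] using h0
    | append_singleton η b ih =>
      cases b
      · simp [hF, ih, padZero]
      · simp [hT, ih, padZero]
  simp only [hh]
  refine ⟨fun η ν e => padZero_injective (List.append_cancel_right (by simpa only [hh] using e)),
    fun η ν hne => ⟨?_, ?_⟩⟩
  · rintro (hp | hp)
    · obtain ⟨ρ, hρ⟩ := exists_padZero_eq_of_prefix hne hp
      exact ⟨padZero η, ρ, Or.inl ⟨rfl, hρ⟩⟩
    · obtain ⟨ρ, hρ⟩ := exists_padZero_eq_of_prefix hne.symm hp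
      exact ⟨padZero ν, ρ, Or.inr ⟨rfl, hρ⟩⟩
  · rintro ⟨ξ, ρ, ⟨e, hρ⟩ | ⟨e, hρ⟩⟩
    · obtain rfl := List.append_cancel_right e
      exact Or.inl (prefix_of_padZero_eq hρ)
    · obtain rfl := List.append_cancel_right e
      exact Or.inr (prefix_of_padZero_eq hρ)
end
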